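/- For all x ∈ ℝ and all y ∈ ℝ with y ≥ 2, one has −x/(x² + y²) + ∑_{n=1}^∞ ( 1/n − (n + x)/((n + x)² + y²) ) > 3/4. Consequently, since the Euler–Mascheroni constant γ satisfies γ < 3/4, the derivative of x' ↦ ‖Γ(x' + i·y)‖ at x, which equals ‖Γ(x + i·y)‖·( −γ − x/(x² + y²) + ∑_{n=1}^∞ (1/n − (n + x)/((n + x)² + y²)) ), is strictly positive. -/

import Mathlib

open Complex Real

open Filter Topology Finset

/-- The `n`-th term of the series for the real part of the digamma function at `x + iy`. -/
noncomputable def reDigammaTerm (x y : ℝ) (n : ℕ) : ℝ :=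
  1 / ((n : ℝ) + 1) - (((n : ℝ) + 1) + x) / ((((n : ℝ) + 1) + x) ^ 2 + y ^ 2)

lemma abs_reDigammaTerm_le (x : ℝ) {y : ℝ} (hy : 0 < y) (n : ℕ) :
    |reDigammaTerm x y n| ≤ (x ^ 2 + y ^ 2) / y * (1 / ((n : ℝ) + 1) ^ 2) := by
  unfold reDigammaTerm
  set m : ℝ := (n : ℝ) + 1 with hm
  have hm0 : 0 < m := by positivity
  have hD : 0 < (m + x) ^ 2 + y ^ 2 := by positivity
  have hC : 0 < x ^ 2 + y ^ 2 := by positivity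
  have lagrange : ((m + x) ^ 2 + y ^ 2) * (x ^ 2 + y ^ 2)
      = (x * (m + x) + y ^ 2) ^ 2 + (y * m) ^ 2 := by ring
  have hterm : 1 / m - (m + x) / ((m + x) ^ 2 + y ^ 2)
      = (x * (m + x) + y ^ 2) / (m * ((m + x) ^ 2 + y ^ 2)) := by
    field_simp
    ring
  rw [hterm, abs_div, abs_of_pos (mul_pos hm0 hD), div_mul_div_comm, mul_one,
    div_le_div_iff₀ (by positivity) (by positivity)]
  have key : |x * (m + x) + y ^ 2| * (y * m) ≤ (x ^ 2 + y ^ 2) * ((m + x) ^ 2 + y ^ 2) := by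
    have h := two_mul_le_add_sq |x * (m + x) + y ^ 2| (y * m)
    rw [sq_abs] at h
    have : 0 ≤ |x * (m + x) + y ^ 2| * (y * m) := by positivity
    linarith
  calc |x * (m + x) + y ^ 2| * (y * m ^ 2)
      = |x * (m + x) + y ^ 2| * (y * m) * m := by ring
    _ ≤ (x ^ 2 + y ^ 2) * ((m + x) ^ 2 + y ^ 2) * m := by gcongr
    _ = _ := by ring

lemma summable_one_div_add_one_sq : Summable fun n : ℕ => 1 / ((n : ℝ) + 1) ^ 2 := by
  have h := (summable_nat_add_iff 1).2 (Real.summable_one_div_nat_pow.2 (one_lt_two))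
  simpa using h

lemma summable_reDigammaTerm (x : ℝ) {y : ℝ} (hy : 0 < y) : Summable (reDigammaTerm x y) :=
  .of_norm_bounded (summable_one_div_add_one_sq.mul_left _) fun n => abs_reDigammaTerm_le x hy n

lemma sum_reDigammaTerm (x y : ℝ) (N : ℕ) :
    -(x / (x ^ 2 + y ^ 2)) + ∑ n ∈ range N, reDigammaTerm x y n
      = harmonic N - ∑ n ∈ range (N + 1), (x + n) / ((x + n) ^ 2 + y ^ 2) := by
  rw [sum_range_succ']
  simp only [reDigammaTerm, sum_sub_distrib, harmonic]
  push_cast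
  simp only [one_div, add_comm x]
  ring

lemma two_mul_sub_div_add_le_log_sub_log {a b : ℝ} (hb : 0 < b) (hab : b ≤ a) :
    2 * (a - b) / (a + b) ≤ Real.log a - Real.log b := by
  have ha : 0 < a := hb.trans_le hab
  have h := Real.le_log_one_add_of_nonneg (x := (a - b) / b)
    (div_nonneg (sub_nonneg.2 hab) hb.le)
  have e₁ : 1 + (a - b) / b = a / b := by field_simp; ring
  have e₂ : 2 * ((a - b) / b) / ((a - b) / b + 2) = 2 * (a - b) / (a + b) := by
    have : (a - b) / b + 2 = (a + b) / b := by field_simp; ring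
    rw [this]
    field_simp
  rwa [e₁, e₂, Real.log_div ha.ne' hb.ne'] at h

lemma log_sub_log_le_div_sub_div {a b : ℝ} (ha : 0 < a) (hab : a ≤ b) :
    Real.log b - Real.log a ≤ (b / a - a / b) / 2 := by
  have hb : 0 < b := ha.trans_le hab
  have h := Real.self_le_sinh_iff.2 (Real.log_nonneg ((one_le_div ha).2 hab))
  rwa [Real.sinh_log (div_pos hb ha), inv_div, Real.log_div hb.ne' ha.ne'] at h

/-- A function whose forward differences dominate `t / (t ^ 2 + y ^ 2)`. -/
noncomputable def logMajorant (y t : ℝ) : ℝ :=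
  if t < 0 then Real.log ((t - 1 / 2) ^ 2 + y ^ 2 + 3 / 4) / 2 - 2 / 15
  else Real.log ((t - 1 / 2) ^ 2 + y ^ 2 - 1 / 4) / 2

lemma log_add_le_log_sub {y : ℝ} (hy : 2 ≤ y) (t : ℝ) :
    Real.log ((t - 1 / 2) ^ 2 + y ^ 2 + 3 / 4) / 2 - 2 / 15
      ≤ Real.log ((t - 1 / 2) ^ 2 + y ^ 2 - 1 / 4) / 2 := by
  have hB : 15 / 4 ≤ (t - 1 / 2) ^ 2 + y ^ 2 - 1 / 4 := by nlinarith [sq_nonneg (t - 1 / 2)]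
  have hA : (t - 1 / 2) ^ 2 + y ^ 2 + 3 / 4 = ((t - 1 / 2) ^ 2 + y ^ 2 - 1 / 4) + 1 := by ring
  rw [hA]
  generalize (t - 1 / 2) ^ 2 + y ^ 2 - 1 / 4 = B at hB
  have hB0 : 0 < B := by linarith
  have h := Real.log_le_sub_one_of_pos (x := (B + 1) / B) (by positivity)
  rw [Real.log_div (by positivity) hB0.ne'] at h
  have : (B + 1) / B - 1 ≤ 4 / 15 := by
    rw [add_div, div_self hB0.ne', add_sub_cancel_left, div_le_iff₀ hB0]
    linarith
  linarith

lemma div_le_logMajorant_sub {y : ℝ} (hy : 2 ≤ y) (t : ℝ) :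
    t / (t ^ 2 + y ^ 2) ≤ logMajorant y (t + 1) - logMajorant y t := by
  have hy2 : 4 ≤ y ^ 2 := by nlinarith
  have hs : 0 < t ^ 2 + y ^ 2 := by positivity
  rcases lt_or_ge t 0 with ht | ht
  · set a := (t + 1 - 1 / 2) ^ 2 + y ^ 2 + 3 / 4 with ha
    set b := (t - 1 / 2) ^ 2 + y ^ 2 + 3 / 4 with hb
    have ha0 : 0 < a := by positivity
    have hb0 : 0 < b := by positivity
    have h := log_sub_log_le_div_sub_div ha0 (b := b) (by rw [ha, hb]; nlinarith)
    have h₁ : t / (t ^ 2 + y ^ 2) ≤ (Real.log a - Real.log b) / 2 := by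
      have e : (b / a - a / b) / 2 = -2 * t * (t ^ 2 + y ^ 2 + 1) / (a * b) := by
        rw [div_sub_div _ _ ha0.ne' hb0.ne', div_div, div_eq_div_iff (by positivity) (by positivity),
          ha, hb]
        ring
      have e' : -2 * t * (t ^ 2 + y ^ 2 + 1) / (a * b) ≤ -2 * t / (t ^ 2 + y ^ 2) := by
        rw [div_le_div_iff₀ (by positivity) hs, mul_assoc (-2 * t)]
        refine mul_le_mul_of_nonneg_left ?_ (by linarith)
        rw [ha, hb]
        nlinarith
      rw [e] at h
      have e'' : -2 * t / (t ^ 2 + y ^ 2) = -2 * (t / (t ^ 2 + y ^ 2)) := by ring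
      linarith
    have h₂ : Real.log a / 2 - 2 / 15 ≤ logMajorant y (t + 1) := by
      unfold logMajorant
      split_ifs
      · exact le_rfl
      · exact log_add_le_log_sub hy (t + 1)
    have h₃ : logMajorant y t = Real.log b / 2 - 2 / 15 := if_pos ht
    linarith
  · rw [logMajorant, logMajorant, if_neg (by linarith), if_neg (by linarith), ← sub_div]
    have h := two_mul_sub_div_add_le_log_sub_log (a := (t + 1 - 1 / 2) ^ 2 + y ^ 2 - 1 / 4)
      (b := (t - 1 / 2) ^ 2 + y ^ 2 - 1 / 4) (by nlinarith [sq_nonneg (t - 1 / 2)]) (by nlinarith)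
    have e : 2 * (((t + 1 - 1 / 2) ^ 2 + y ^ 2 - 1 / 4) - ((t - 1 / 2) ^ 2 + y ^ 2 - 1 / 4)) /
        (((t + 1 - 1 / 2) ^ 2 + y ^ 2 - 1 / 4) + ((t - 1 / 2) ^ 2 + y ^ 2 - 1 / 4))
        = 2 * (t / (t ^ 2 + y ^ 2)) := by
      rw [← mul_div_assoc, div_eq_div_iff (by nlinarith) hs.ne']
      ring
    linarith

lemma sum_div_le_logMajorant_sub {y : ℝ} (hy : 2 ≤ y) (x : ℝ) (N : ℕ) :
    ∑ n ∈ range N, (x + n) / ((x + n) ^ 2 + y ^ 2)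
      ≤ logMajorant y (x + N) - logMajorant y x := by
  have h : ∀ n ∈ range N, (x + n) / ((x + n) ^ 2 + y ^ 2)
      ≤ logMajorant y (x + (n + 1 : ℕ)) - logMajorant y (x + n) := fun n _ => by
    rw [Nat.cast_succ, ← add_assoc]
    exact div_le_logMajorant_sub hy _
  refine (sum_le_sum h).trans_eq ?_
  rw [sum_range_sub (fun n : ℕ => logMajorant y (x + n)), Nat.cast_zero, add_zero]

lemma lt_logMajorant {y : ℝ} (hy : 2 ≤ y) (t : ℝ) : 1 / 4 < logMajorant y t := by
  have h : ∀ b : ℝ, 15 / 4 ≤ b → 1 ≤ Real.log b := fun b hb =>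
    (Real.le_log_iff_exp_le (by linarith)).2 (by linarith [Real.exp_one_lt_d9])
  unfold logMajorant
  split_ifs
  · linarith [h ((t - 1 / 2) ^ 2 + y ^ 2 + 3 / 4) (by nlinarith [sq_nonneg (t - 1 / 2)])]
  · linarith [h ((t - 1 / 2) ^ 2 + y ^ 2 - 1 / 4) (by nlinarith [sq_nonneg (t - 1 / 2)])]

lemma tendsto_logMajorant_sub_log {y : ℝ} (hy : 2 ≤ y) (x : ℝ) :
    Tendsto (fun N : ℕ => logMajorant y (x + (N + 1 : ℕ)) - Real.log N) atTop (𝓝 0) := by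
  have hinv : Tendsto (fun N : ℕ => ((N : ℝ))⁻¹) atTop (𝓝 0) :=
    tendsto_inv_atTop_nhds_zero_nat
  have h : Tendsto (fun N : ℕ => Real.log ((1 + (x + 1 / 2) * (N : ℝ)⁻¹) ^ 2 +
      (y ^ 2 - 1 / 4) * (N : ℝ)⁻¹ ^ 2) / 2) atTop (𝓝 0) := by
    have h₁ : Tendsto (fun N : ℕ => (1 + (x + 1 / 2) * (N : ℝ)⁻¹) ^ 2 +
        (y ^ 2 - 1 / 4) * (N : ℝ)⁻¹ ^ 2) atTop (𝓝 1) := by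
      simpa using (((hinv.const_mul (x + 1 / 2)).const_add 1).pow 2).add
        ((hinv.pow 2).const_mul (y ^ 2 - 1 / 4))
    simpa using (h₁.log one_ne_zero).div_const 2
  refine h.congr' ?_
  filter_upwards [eventually_gt_atTop 0, eventually_ge_atTop ⌈-x⌉₊] with N hN hxN
  have hN' : (0 : ℝ) < N := Nat.cast_pos.2 hN
  have hx : -x ≤ N := Nat.ceil_le.1 hxN
  have hpos : 0 < (x + (N + 1 : ℕ) - 1 / 2) ^ 2 + y ^ 2 - 1 / 4 := by
    nlinarith [sq_nonneg (x + (N + 1 : ℕ) - 1 / 2)]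
  have e : (1 + (x + 1 / 2) * (N : ℝ)⁻¹) ^ 2 + (y ^ 2 - 1 / 4) * (N : ℝ)⁻¹ ^ 2
      = ((x + (N + 1 : ℕ) - 1 / 2) ^ 2 + y ^ 2 - 1 / 4) / (N : ℝ) ^ 2 := by
    push_cast
    field_simp
    ring
  rw [e, logMajorant, if_neg (by push_cast; linarith), Real.log_div hpos.ne' (by positivity),
    Real.log_pow]
  push_cast
  ring

lemma three_quarters_lt_tsum_reDigammaTerm (x : ℝ) {y : ℝ} (hy : 2 ≤ y) :
    3 / 4 < -(x / (x ^ 2 + y ^ 2)) + ∑' n, reDigammaTerm x y n := by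
  have hsum := (summable_reDigammaTerm x (y := y) (by linarith)).hasSum.tendsto_sum_nat.const_add
    (-(x / (x ^ 2 + y ^ 2)))
  have hlow := (Real.tendsto_harmonic_sub_log.sub (tendsto_logMajorant_sub_log hy x)).add_const
    (logMajorant y x)
  have h := le_of_tendsto_of_tendsto' hlow hsum fun N => by
    have := sum_div_le_logMajorant_sub hy x (N + 1)
    rw [sum_reDigammaTerm]
    linarith
  linarith [Real.one_half_lt_eulerMascheroniConstant, lt_logMajorant hy x]

lemma norm_ofReal_add_I_mul_add_natCast (x y : ℝ) (n : ℕ) :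
    ‖(x + Complex.I * y + n : ℂ)‖ = √((x + n) ^ 2 + y ^ 2) := by
  have : (x + Complex.I * y + n : ℂ) = ((x + n : ℝ) : ℂ) + y * Complex.I := by
    push_cast
    ring
  rw [this, Complex.norm_add_mul_I]

lemma log_norm_GammaSeq (x : ℝ) {y : ℝ} (hy : 0 < y) {n : ℕ} (hn : 0 < n) :
    Real.log ‖Complex.GammaSeq (x + Complex.I * y) n‖
      = x * Real.log n + Real.log n.factorial
        - ∑ j ∈ range (n + 1), Real.log ((x + j) ^ 2 + y ^ 2) / 2 := by
  have hn' : (0 : ℝ) < n := Nat.cast_pos.2 hn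
  have hpos : ∀ j : ℕ, 0 < √((x + j) ^ 2 + y ^ 2) := fun j => by positivity
  have hre : (x + Complex.I * y : ℂ).re = x := by simp
  rw [Complex.GammaSeq, norm_div, norm_mul, norm_prod, Complex.norm_natCast,
    Complex.norm_natCast_cpow_of_pos hn, hre]
  simp_rw [norm_ofReal_add_I_mul_add_natCast]
  rw [Real.log_div (by positivity) (prod_ne_zero_iff.2 fun j _ => (hpos j).ne'),
    Real.log_mul (by positivity) (by positivity), Real.log_rpow hn',
    Real.log_prod fun j _ => (hpos j).ne']
  congr 1
  exact sum_congr rfl fun j _ => Real.log_sqrt (by positivity)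

lemma Gamma_ofReal_add_I_mul_ne_zero (x : ℝ) {y : ℝ} (hy : 0 < y) :
    Complex.Gamma (x + Complex.I * y) ≠ 0 :=
  Complex.Gamma_ne_zero fun m h => hy.ne' (by simpa using congrArg Complex.im h)

lemma hasDerivAt_log_norm_Gamma (x : ℝ) {y : ℝ} (hy : 0 < y) :
    HasDerivAt (fun t : ℝ => Real.log ‖Complex.Gamma (t + Complex.I * y)‖)
      (-Real.eulerMascheroniConstant +
        (-(x / (x ^ 2 + y ^ 2)) + ∑' n, reDigammaTerm x y n)) x := by
  set s : Set ℝ := Metric.ball 0 (|x| + 1) with hs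
  have hxs : x ∈ s := by simp [hs]
  have hsum : TendstoUniformlyOn (fun N t => ∑ n ∈ range N, reDigammaTerm t y n)
      (fun t => ∑' n, reDigammaTerm t y n) atTop s := by
    refine tendstoUniformlyOn_tsum_nat
      (summable_one_div_add_one_sq.mul_left (((|x| + 1) ^ 2 + y ^ 2) / y)) fun n t ht => ?_
    refine (abs_reDigammaTerm_le t hy n).trans ?_
    have : t ^ 2 ≤ (|x| + 1) ^ 2 := by
      rw [← sq_abs t]
      have : |t| < |x| + 1 := by simpa [hs] using ht
      gcongr
    gcongr
  have hharm : TendstoUniformlyOn (fun (N : ℕ) (_ : ℝ) => -((harmonic N : ℝ) - Real.log N))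
      (fun _ => -Real.eulerMascheroniConstant) atTop s :=
    Real.tendsto_harmonic_sub_log.neg.tendstoUniformlyOn_const s
  have hzero : TendstoUniformlyOn (fun (_ : ℕ) (t : ℝ) => -(t / (t ^ 2 + y ^ 2)))
      (fun t => -(t / (t ^ 2 + y ^ 2))) atTop s := fun u hu =>
    Eventually.of_forall fun _ _ _ => refl_mem_uniformity hu
  refine hasDerivAt_of_tendstoUniformlyOn (l := atTop)
    (f := fun (N : ℕ) t => t * Real.log N + Real.log N.factorial
        - ∑ j ∈ range (N + 1), Real.log ((t + j) ^ 2 + y ^ 2) / 2)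
    (g' := fun t => -Real.eulerMascheroniConstant +
        (-(t / (t ^ 2 + y ^ 2)) + ∑' n, reDigammaTerm t y n))
    Metric.isOpen_ball (hharm.add (hzero.add hsum)) ?_ ?_ hxs
  · refine Eventually.of_forall fun N t _ => ?_
    have hlog : ∀ j ∈ range (N + 1), HasDerivAt
        (fun t : ℝ => Real.log ((t + j) ^ 2 + y ^ 2) / 2)
        ((t + j) / ((t + j) ^ 2 + y ^ 2)) t := fun j _ => by
      have h : HasDerivAt (fun t : ℝ => (t + j) ^ 2 + y ^ 2) (2 * (t + j)) t := by
        simpa using (((hasDerivAt_id t).add_const (j : ℝ)).pow 2).add_const (y ^ 2)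
      convert! (h.log (by positivity)).div_const 2 using 1
      ring
    have h := (((hasDerivAt_id t).mul_const (Real.log N)).add_const
      (Real.log N.factorial)).sub (HasDerivAt.fun_sum hlog)
    convert! h using 1
    simp only [Pi.add_apply]
    rw [sum_reDigammaTerm]
    ring
  · intro t _
    have h := (Complex.GammaSeq_tendsto_Gamma (t + Complex.I * y)).norm.log
      (norm_ne_zero_iff.2 (Gamma_ofReal_add_I_mul_ne_zero t hy))
    refine h.congr' ?_
    filter_upwards [eventually_gt_atTop 0] with N hN
    exact log_norm_GammaSeq t hy hN

lemma hasDerivAt_norm_Gamma (x : ℝ) {y : ℝ} (hy : 0 < y) :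
    HasDerivAt (fun t : ℝ => ‖Complex.Gamma (t + Complex.I * y)‖)
      (‖Complex.Gamma (x + Complex.I * y)‖ * (-Real.eulerMascheroniConstant +
        (-(x / (x ^ 2 + y ^ 2)) + ∑' n, reDigammaTerm x y n))) x := by
  have hexp : ∀ t : ℝ, Real.exp (Real.log ‖Complex.Gamma (t + Complex.I * y)‖)
      = ‖Complex.Gamma (t + Complex.I * y)‖ := fun t =>
    Real.exp_log (norm_pos_iff.2 (Gamma_ofReal_add_I_mul_ne_zero t hy))
  simpa only [hexp] using (hasDerivAt_log_norm_Gamma x hy).exp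

/-- For `y ≥ 2`, the series bound `-x/(x²+y²) + ∑ (1/n - (n+x)/((n+x)²+y²)) > 3/4` holds,
and consequently the derivative of `x' ↦ ‖Γ(x' + iy)‖` at `x`, which equals
`‖Γ(x+iy)‖·(−γ − x/(x²+y²) + ∑ (1/n − (n+x)/((n+x)²+y²)))`, is strictly positive. -/
theorem stmt_10 (x y : ℝ) (hy : 2 ≤ y) :
    (3 / 4 < -x / (x ^ 2 + y ^ 2) +
      ∑' n : ℕ,
        (1 / ((n : ℝ) + 1) -
          (((n : ℝ) + 1) + x) / ((((n : ℝ) + 1) + x) ^ 2 + y ^ 2))) ∧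
    HasDerivAt (fun x' : ℝ => ‖Complex.Gamma (x' + Complex.I * y)‖)
      (‖Complex.Gamma (x + Complex.I * y)‖ *
        (-Real.eulerMascheroniConstant - x / (x ^ 2 + y ^ 2) +
          ∑' n : ℕ,
            (1 / ((n : ℝ) + 1) -
              (((n : ℝ) + 1) + x) / ((((n : ℝ) + 1) + x) ^ 2 + y ^ 2)))) x ∧
    0 < ‖Complex.Gamma (x + Complex.I * y)‖ *
        (-Real.eulerMascheroniConstant - x / (x ^ 2 + y ^ 2) +
          ∑' n : ℕ,
            (1 / ((n : ℝ) + 1) -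
              (((n : ℝ) + 1) + x) / ((((n : ℝ) + 1) + x) ^ 2 + y ^ 2))) := by
  have hy0 : 0 < y := by linarith
  have hbound := three_quarters_lt_tsum_reDigammaTerm x hy
  have hderiv := hasDerivAt_norm_Gamma x hy0
  have hGamma : 0 < ‖Complex.Gamma (x + Complex.I * y)‖ :=
    norm_pos_iff.2 (Gamma_ofReal_add_I_mul_ne_zero x hy0)
  rw [← add_assoc, ← sub_eq_add_neg] at hderiv
  refine ⟨by rwa [neg_div], hderiv, mul_pos hGamma ?_⟩
  change 0 < -Real.eulerMascheroniConstant - x / (x ^ 2 + y ^ 2) + ∑' n, reDigammaTerm x y n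
  linarith [Real.eulerMascheroniConstant_lt_two_thirds]
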